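/- arXiv:math/0406470 — 4 statements merged into one kernel-verified Lean document; each statement's English description precedes it below -/
import Mathlib

section
/- Let X be an n×p real matrix and y ∈ ℝⁿ, and for each λ ≥ 0 consider the Lasso objective F_λ(β) = ‖y − Xβ‖₂² + λ‖β‖₁ on ℝᵖ. Then there exists a selection of minimizers β̂ : [0,∞) → ℝᵖ (i.e., for every λ ≥ 0, β̂(λ) minimizes F_λ) and finitely many breakpoints λ₀ > λ₁ > ⋯ > λ_m = 0 together with direction vectors γ₀, …, γ_{m−1} ∈ ℝᵖ such that β̂(λ) = 0 for all λ ≥ λ₀, and for every k and every λ with λ_{k+1} ≤ λ ≤ λ_k one has β̂(λ) = β̂(λ_k) − (λ − λ_k)γ_k; in particular the Lasso solution path λ ↦ β̂(λ) is piecewise linear (piecewise affine) in λ. -/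
open scoped BigOperators

namespace LassoAux

variable {n p : ℕ} (X : Matrix (Fin n) (Fin p) ℝ) (y : Fin n → ℝ)

/-- residual -/
def res (β : Fin p → ℝ) (i : Fin n) : ℝ := y i - ∑ j, X i j * β j

/-- gradient correlation -/
def cor (β : Fin p → ℝ) (j : Fin p) : ℝ := 2 * ∑ i, X i j * res X y β i

/-- Lasso objective -/
def obj (l : ℝ) (β : Fin p → ℝ) : ℝ := (∑ i, (res X y β i) ^ 2) + l * ∑ j, |β j|

/-- KKT cell -/
def Cell (σ : Fin p → SignType) (l : ℝ) (β : Fin p → ℝ) : Prop :=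
  ∀ j, |cor X y β j| ≤ l ∧ (σ j : ℝ) * β j = |β j| ∧ (σ j ≠ 0 → cor X y β j = (σ j : ℝ) * l)

lemma res_comb (a b : ℝ) (hab : a + b = 1) (u v : Fin p → ℝ) (i : Fin n) :
    res X y (a • u + b • v) i = a * res X y u i + b * res X y v i := by
  simp only [res, Pi.add_apply, Pi.smul_apply, smul_eq_mul, mul_add, Finset.sum_add_distrib,
    mul_sub, Finset.mul_sum]
  have h1 : ∀ j, X i j * (a * u j) = a * (X i j * u j) := fun j => by ring
  have h2 : ∀ j, X i j * (b * v j) = b * (X i j * v j) := fun j => by ring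
  simp only [h1, h2]
  have : y i = a * y i + b * y i := by rw [← add_mul, hab, one_mul]
  linarith

lemma cor_comb (a b : ℝ) (hab : a + b = 1) (u v : Fin p → ℝ) (j : Fin p) :
    cor X y (a • u + b • v) j = a * cor X y u j + b * cor X y v j := by
  simp only [cor, res_comb X y a b hab, mul_add, Finset.sum_add_distrib, Finset.mul_sum]
  congr 1 <;> exact Finset.sum_congr rfl fun i _ => by ring

lemma continuous_res (i : Fin n) : Continuous fun β : Fin p → ℝ => res X y β i := by
  unfold res; fun_prop

lemma continuous_cor (j : Fin p) : Continuous fun β : Fin p → ℝ => cor X y β j := by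
  have := continuous_res X y
  unfold cor; fun_prop

lemma obj_expand (l : ℝ) (β β' : Fin p → ℝ) :
    obj X y l β' = obj X y l β + ∑ i, (res X y β' i - res X y β i) ^ 2
      + ∑ j, (l * |β' j| - cor X y β j * β' j - (l * |β j| - cor X y β j * β j)) := by
  have h1 : ∑ j, cor X y β j * (β' j - β j) =
      ∑ i, 2 * res X y β i * (res X y β i - res X y β' i) := by
    have : ∀ i, res X y β i - res X y β' i = ∑ j, X i j * (β' j - β j) := by
      intro i; simp only [res, mul_sub, Finset.sum_sub_distrib]; ring
    simp only [this, cor, Finset.mul_sum, Finset.sum_mul]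
    rw [Finset.sum_comm]
    exact Finset.sum_congr rfl fun i _ => Finset.sum_congr rfl fun j _ => by ring
  have h2 : ∑ j, (l * |β' j| - cor X y β j * β' j - (l * |β j| - cor X y β j * β j))
      = l * ∑ j, |β' j| - l * ∑ j, |β j| - ∑ j, cor X y β j * (β' j - β j) := by
    rw [Finset.mul_sum, Finset.mul_sum, ← Finset.sum_sub_distrib, ← Finset.sum_sub_distrib]
    exact Finset.sum_congr rfl fun j _ => by ring
  have h3 : ∑ i, (res X y β' i) ^ 2 = ∑ i, (res X y β i) ^ 2
      + ∑ i, (res X y β' i - res X y β i) ^ 2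
      - ∑ i, 2 * res X y β i * (res X y β i - res X y β' i) := by
    rw [← Finset.sum_add_distrib, ← Finset.sum_sub_distrib]
    exact Finset.sum_congr rfl fun j _ => by ring
  rw [h2, h1]; unfold obj; rw [h3]; ring

lemma Cell.obj_le {σ : Fin p → SignType} {l : ℝ} {β : Fin p → ℝ} (h : Cell X y σ l β)
    (β' : Fin p → ℝ) :
    obj X y l β + ∑ i, (res X y β' i - res X y β i) ^ 2 ≤ obj X y l β' := by
  rw [obj_expand X y l β β']
  have : 0 ≤ ∑ j, (l * |β' j| - cor X y β j * β' j - (l * |β j| - cor X y β j * β j)) := by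
    refine Finset.sum_nonneg fun j _ => ?_
    obtain ⟨h1, h2, h3⟩ := h j
    have e : l * |β j| = cor X y β j * β j := by
      by_cases hs : σ j = 0
      · rw [hs] at h2; simp at h2
        have : β j = 0 := abs_eq_zero.1 h2.symm
        simp [this]
      · rw [h3 hs, ← h2]; ring
    have : cor X y β j * β' j ≤ l * |β' j| :=
      (le_abs_self _).trans (by rw [abs_mul]; gcongr)
    linarith
  linarith

lemma Cell.min {σ : Fin p → SignType} {l : ℝ} {β : Fin p → ℝ} (h : Cell X y σ l β)
    (β' : Fin p → ℝ) : obj X y l β ≤ obj X y l β' := by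
  have := h.obj_le X y β'
  have : 0 ≤ ∑ i, (res X y β' i - res X y β i) ^ 2 := Finset.sum_nonneg fun _ _ => sq_nonneg _
  linarith

lemma Cell.unique {σ τ : Fin p → SignType} {l : ℝ} (hl : 0 < l) {β β' : Fin p → ℝ}
    (h : Cell X y σ l β) (h' : Cell X y τ l β') :
    (∀ i, res X y β' i = res X y β i) ∧ ∑ j, |β' j| = ∑ j, |β j| := by
  have h1 := h.obj_le X y β'
  have h2 := h'.min X y β
  have h3 := h.min X y β'
  have h0 : ∑ i, (res X y β' i - res X y β i) ^ 2 = 0 :=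
    le_antisymm (by linarith) (Finset.sum_nonneg fun _ _ => sq_nonneg _)
  rw [Finset.sum_eq_zero_iff_of_nonneg fun _ _ => sq_nonneg _] at h0
  have hr : ∀ i, res X y β' i = res X y β i := fun i => by
    have := h0 i (Finset.mem_univ _)
    exact sub_eq_zero.1 (pow_eq_zero_iff two_ne_zero |>.1 this)
  refine ⟨hr, ?_⟩
  have e := le_antisymm h2 h3
  unfold obj at e
  simp only [hr] at e
  exact mul_left_cancel₀ hl.ne' (add_left_cancel e)

lemma Cell.norm_eq {σ : Fin p → SignType} {l : ℝ} {β : Fin p → ℝ} (h : Cell X y σ l β) :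
    ∑ j, |β j| = ∑ j, (σ j : ℝ) * β j :=
  Finset.sum_congr rfl fun j _ => (h j).2.1.symm

lemma Cell.comb {σ : Fin p → SignType} {l l' : ℝ} {u v : Fin p → ℝ}
    (hu : Cell X y σ l u) (hv : Cell X y σ l' v) {a b : ℝ} (ha : 0 ≤ a) (hb : 0 ≤ b)
    (hab : a + b = 1) : Cell X y σ (a * l + b * l') (a • u + b • v) := by
  intro j
  obtain ⟨h1, h2, h3⟩ := hu j
  obtain ⟨k1, k2, k3⟩ := hv j
  rw [cor_comb X y a b hab]
  refine ⟨?_, ?_, fun hs => ?_⟩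
  · refine (abs_add_le _ _).trans ?_
    rw [abs_mul, abs_mul, abs_of_nonneg ha, abs_of_nonneg hb]
    gcongr
  · simp only [Pi.add_apply, Pi.smul_apply, smul_eq_mul]
    have e : (σ j : ℝ) * (a * u j + b * v j) = a * |u j| + b * |v j| := by
      rw [← h2, ← k2]; ring
    apply le_antisymm
    · rcases hσ : σ j with _ | _ | _
      · simp
      · simp only [SignType.neg_eq_neg_one, SignType.coe_neg, SignType.coe_one]; have := neg_le_abs (a * u j + b * v j); linarith
      · simp [le_abs_self]
    · rw [e]
      refine (abs_add_le _ _).trans ?_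
      rw [abs_mul, abs_mul, abs_of_nonneg ha, abs_of_nonneg hb]
  · rw [h3 hs, k3 hs]; ring

/-- small-step one-dimensional fact -/
lemma lin_nonneg {a d δ : ℝ} (hδ : 0 < δ) (h : ∀ t, 0 < t → t ≤ δ → 0 ≤ t ^ 2 * a + t * d) :
    0 ≤ d := by
  by_contra hd
  push Not at hd
  have ha : 0 < |a| + 1 := by positivity
  set t := min δ (-d / (2 * (|a| + 1))) with ht
  have htp : 0 < t := lt_min hδ (div_pos (by linarith) (by positivity))
  have h1 := h t htp (min_le_left _ _)
  have h2 : t * (2 * (|a| + 1)) ≤ -d := by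
    rw [← le_div_iff₀ (by positivity)]; exact min_le_right _ _
  have h3 : 0 ≤ t * a + d := by
    have : 0 ≤ t * (t * a + d) := by nlinarith
    exact nonneg_of_mul_nonneg_right this htp
  have : t * a ≤ t * |a| := by gcongr; exact le_abs_self a
  nlinarith [mul_nonneg htp.le (abs_nonneg a)]

lemma exists_cell_of_min {l : ℝ} (hl : 0 ≤ l) {β : Fin p → ℝ}
    (h : ∀ β', obj X y l β ≤ obj X y l β') :
    ∃ σ, Cell X y σ l β := by
  refine ⟨fun j => SignType.sign (β j), fun j => ?_⟩
  have key : ∀ t : ℝ, 0 ≤ t ^ 2 * (∑ i, X i j ^ 2) + (l * (|β j + t| - |β j|)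
      - t * cor X y β j) := by
    intro t
    have h1 := h (Function.update β j (β j + t))
    rw [obj_expand X y l β (Function.update β j (β j + t))] at h1
    have e1 : ∑ k, (l * |Function.update β j (β j + t) k|
        - cor X y β k * Function.update β j (β j + t) k - (l * |β k| - cor X y β k * β k))
        = (l * (|β j + t| - |β j|) - t * cor X y β j) := by
      rw [Finset.sum_eq_single j]
      · simp; ring
      · intro k _ hk; simp [Function.update_of_ne hk]
      · simp
    have e2 : ∑ i, (res X y (Function.update β j (β j + t)) i - res X y β i) ^ 2
        = t ^ 2 * (∑ i, X i j ^ 2) := by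
      rw [Finset.mul_sum]
      refine Finset.sum_congr rfl fun i _ => ?_
      have : res X y (Function.update β j (β j + t)) i - res X y β i = - (X i j * t) := by
        have : ∑ k, (X i k * Function.update β j (β j + t) k - X i k * β k) = X i j * t := by
          rw [Finset.sum_eq_single j]
          · simp; ring
          · intro k _ hk; simp [Function.update_of_ne hk]
          · simp
        rw [Finset.sum_sub_distrib] at this
        unfold res; linarith
      rw [this]; ring
    rw [e1, e2] at h1
    linarith
  set A := ∑ i, X i j ^ 2
  set c := cor X y β j
  have hpos : ∀ δ > 0, (∀ t, 0 < t → t ≤ δ → |β j + t| - |β j| = t) → c ≤ l := by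
    intro δ hδ hh
    have := lin_nonneg (a := A) (d := l - c) hδ fun t h1 h2 => by
      have := key t; rw [hh t h1 h2] at this; linarith
    linarith
  have hneg : ∀ δ > 0, (∀ t, 0 < t → t ≤ δ → |β j + -t| - |β j| = -t) → l ≤ c := by
    intro δ hδ hh
    have := lin_nonneg (a := A) (d := c - l) hδ fun t h1 h2 => by
      have := key (-t); rw [hh t h1 h2] at this; linarith
    linarith
  have hpos' : ∀ δ > 0, (∀ t, 0 < t → t ≤ δ → |β j + t| - |β j| = -t) → c ≤ -l := by
    intro δ hδ hh
    have := lin_nonneg (a := A) (d := -l - c) hδ fun t h1 h2 => by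
      have := key t; rw [hh t h1 h2] at this; linarith
    linarith
  have hneg' : ∀ δ > 0, (∀ t, 0 < t → t ≤ δ → |β j + -t| - |β j| = t) → -l ≤ c := by
    intro δ hδ hh
    have := lin_nonneg (a := A) (d := c + l) hδ fun t h1 h2 => by
      have := key (-t); rw [hh t h1 h2] at this; linarith
    linarith
  have hcl : |c| ≤ l ∧ (SignType.sign (β j) ≠ 0 → c = (SignType.sign (β j) : ℝ) * l) := by
    rcases lt_trichotomy (β j) 0 with hb | hb | hb
    · have h1 := hpos' (-β j) (by linarith) fun t h1 h2 => by
        rw [abs_of_nonpos (by linarith), abs_of_neg hb]; ring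
      have h2 := hneg' 1 one_pos fun t h1 h2 => by
        rw [abs_of_nonpos (by linarith), abs_of_neg hb]; ring
      have h3 : c = -l := le_antisymm h1 h2
      refine ⟨?_, fun _ => ?_⟩
      · rw [h3, abs_neg, abs_of_nonneg hl]
      · rw [sign_neg hb, h3]; simp
    · have h1 := hpos 1 one_pos fun t h1 h2 => by
        rw [hb, zero_add, abs_of_pos h1]; simp
      have h2 := hneg' 1 one_pos fun t h1 h2 => by
        rw [hb, zero_add, abs_neg, abs_of_pos h1]; simp
      refine ⟨abs_le.2 ⟨h2, h1⟩, fun h => ?_⟩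
      rw [hb] at h; simp at h
    · have h1 := hpos 1 one_pos fun t h1 h2 => by
        rw [abs_of_nonneg (by linarith), abs_of_pos hb]; ring
      have h2 := hneg (β j) hb fun t h1 h2 => by
        rw [abs_of_nonneg (by linarith), abs_of_pos hb]; ring
      have h3 : c = l := le_antisymm h1 h2
      refine ⟨?_, fun _ => ?_⟩
      · rw [h3, abs_of_nonneg hl]
      · rw [sign_pos hb, h3]; simp
  exact ⟨hcl.1, sign_mul_self _, hcl.2⟩


lemma exists_ls : ∃ σ β, Cell X y σ 0 β := by
  have hr : LinearMap.range (X.transpose * X).mulVecLin = LinearMap.range X.transpose.mulVecLin := by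
    apply Submodule.eq_of_le_of_finrank_eq
    · rw [Matrix.mulVecLin_mul]; exact LinearMap.range_comp_le_range _ _
    · have h1 := Matrix.rank_transpose_mul_self X
      have h2 := Matrix.rank_transpose X
      rw [← h2] at h1
      exact h1
  have : X.transpose.mulVecLin y ∈ LinearMap.range (X.transpose * X).mulVecLin := by
    rw [hr]; exact ⟨y, rfl⟩
  obtain ⟨β, hβ⟩ := this
  refine ⟨fun j => SignType.sign (β j), β, fun j => ?_⟩
  have : cor X y β j = 0 := by
    have h := congrFun hβ j
    simp only [Matrix.mulVecLin_apply, ← Matrix.mulVec_mulVec] at h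
    simp only [Matrix.mulVec, dotProduct, Matrix.transpose_apply] at h
    simp only [cor, res, mul_sub, Finset.sum_sub_distrib]
    linarith
  rw [this]
  exact ⟨by simp, sign_mul_self _, by simp⟩

lemma continuous_obj (l : ℝ) : Continuous (obj X y l) := by
  have := continuous_res X y
  unfold obj; fun_prop

lemma isCompact_l1 (B : ℝ) : IsCompact {β : Fin p → ℝ | ∑ j, |β j| ≤ B} := by
  refine (isCompact_Icc (a := fun _ : Fin p => -B) (b := fun _ => B)).of_isClosed_subset
    (isClosed_le (by fun_prop) continuous_const) ?_
  intro β hβ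
  have : ∀ j, |β j| ≤ B := fun j =>
    (Finset.single_le_sum (f := fun j => |β j|) (fun _ _ => abs_nonneg _)
      (Finset.mem_univ j)).trans hβ
  exact ⟨fun j => (abs_le.1 (this j)).1, fun j => (abs_le.1 (this j)).2⟩

lemma exists_bound : ∃ B : ℝ, ∀ l, 0 ≤ l → ∃ σ β, Cell X y σ l β ∧ ∑ j, |β j| ≤ B := by
  obtain ⟨τ, b, hb⟩ := exists_ls X y
  refine ⟨∑ j, |b j|, fun l hl => ?_⟩
  obtain ⟨β, hβ, hmin⟩ := (isCompact_l1 (p := p) (∑ j, |b j|)).exists_isMinOn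
    ⟨b, le_refl (∑ j, |b j|)⟩ (continuous_obj X y l).continuousOn
  have : ∀ β', obj X y l β ≤ obj X y l β' := by
    intro β'
    by_cases h : ∑ j, |β' j| ≤ ∑ j, |b j|
    · exact hmin h
    · refine (hmin (le_refl (∑ j, |b j|) : b ∈ {β : Fin p → ℝ | ∑ j, |β j| ≤ _})).trans ?_
      have h1 := hb.min X y β'
      unfold obj at h1 ⊢
      have : l * ∑ j, |b j| ≤ l * ∑ j, |β' j| := by
        exact mul_le_mul_of_nonneg_left (not_le.1 h).le hl
      linarith
  obtain ⟨σ, hσ⟩ := exists_cell_of_min X y hl this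
  exact ⟨σ, β, hσ, hβ⟩

lemma isClosed_cell (σ : Fin p → SignType) :
    IsClosed {q : ℝ × (Fin p → ℝ) | Cell X y σ q.1 q.2} := by
  unfold Cell
  simp only [Set.ofPred_forall, Set.ofPred_and]
  refine isClosed_iInter fun j => ?_
  have hc : Continuous fun q : ℝ × (Fin p → ℝ) => cor X y q.2 j :=
    (continuous_cor X y j).comp continuous_snd
  refine (isClosed_le (by fun_prop) (by fun_prop)).inter
    ((isClosed_eq (by fun_prop) (by fun_prop)).inter ?_)
  exact isClosed_iInter fun _ => isClosed_eq (by fun_prop) (by fun_prop)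

/-- Breakpoints: a strictly decreasing partition of `[0, L]`. -/
lemma exists_breakpoints (L : ℝ) (hL : 0 < L) : ∃ (m : ℕ) (lam : Fin (m + 1) → ℝ),
    StrictAnti lam ∧ lam (Fin.last m) = 0 ∧ lam 0 = L ∧
    ∀ k : Fin m, ∃ σ u v, Cell X y σ (lam k.castSucc) u ∧ Cell X y σ (lam k.succ) v := by
  classical
  obtain ⟨B, hB⟩ := exists_bound X y
  let C : (Fin p → SignType) → Set (ℝ × (Fin p → ℝ)) := fun σ =>
    (Set.Icc 0 L ×ˢ {β : Fin p → ℝ | ∑ j, |β j| ≤ B}) ∩ {q | Cell X y σ q.1 q.2}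
  have hC : ∀ σ, IsCompact (C σ) := fun σ =>
    (isCompact_Icc.prod (isCompact_l1 B)).inter_right (isClosed_cell X y σ)
  let I : (Fin p → SignType) → Set ℝ := fun σ => Prod.fst '' C σ
  have hI : ∀ σ, IsCompact (I σ) := fun σ => (hC σ).image continuous_fst
  have hsub : ∀ σ, I σ ⊆ Set.Icc 0 L := by
    rintro σ _ ⟨q, hq, rfl⟩; exact hq.1.1
  have hmem : ∀ σ l, l ∈ I σ → ∃ u, Cell X y σ l u := by
    rintro σ _ ⟨q, hq, rfl⟩; exact ⟨q.2, hq.2⟩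
  have hcov : ∀ l ∈ Set.Icc 0 L, ∃ σ, l ∈ I σ := by
    intro l hl
    obtain ⟨σ, β, h1, h2⟩ := hB l hl.1
    exact ⟨σ, (l, β), ⟨⟨hl, h2⟩, h1⟩, rfl⟩
  let T : Finset ℝ := insert 0 (insert L
    (((Finset.univ.filter fun σ => (I σ).Nonempty).image fun σ => sInf (I σ)) ∪
    ((Finset.univ.filter fun σ => (I σ).Nonempty).image fun σ => sSup (I σ))))
  have hT0 : (0 : ℝ) ∈ T := by simp [T]
  have hTL : L ∈ T := by simp [T]
  have hTi : ∀ σ, (I σ).Nonempty → sInf (I σ) ∈ T := by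
    intro σ hσ
    simp only [T, Finset.mem_insert, Finset.mem_union, Finset.mem_image, Finset.mem_filter]
    exact Or.inr (Or.inr (Or.inl ⟨σ, ⟨Finset.mem_univ _, hσ⟩, rfl⟩))
  have hTs : ∀ σ, (I σ).Nonempty → sSup (I σ) ∈ T := by
    intro σ hσ
    simp only [T, Finset.mem_insert, Finset.mem_union, Finset.mem_image, Finset.mem_filter]
    exact Or.inr (Or.inr (Or.inr ⟨σ, ⟨Finset.mem_univ _, hσ⟩, rfl⟩))
  have hTsub : ∀ t ∈ T, t ∈ Set.Icc 0 L := by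
    intro t ht
    simp only [T, Finset.mem_insert, Finset.mem_union, Finset.mem_image, Finset.mem_filter] at ht
    rcases ht with rfl | rfl | ⟨σ, ⟨_, hσ⟩, rfl⟩ | ⟨σ, ⟨_, hσ⟩, rfl⟩
    · exact ⟨le_rfl, hL.le⟩
    · exact ⟨hL.le, le_rfl⟩
    · exact hsub σ ((hI σ).sInf_mem hσ)
    · exact hsub σ ((hI σ).sSup_mem hσ)
  obtain ⟨m, hm⟩ : ∃ m, T.card = m + 1 :=
    Nat.exists_eq_succ_of_ne_zero (Finset.card_pos.2 ⟨0, hT0⟩).ne'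
  let e := T.orderEmbOfFin hm
  have he : ∀ i, e i ∈ T := fun i => T.orderEmbOfFin_mem hm i
  have hsurj : ∀ t ∈ T, ∃ i, e i = t := by
    intro t ht
    have : t ∈ Set.range e := by rw [Finset.range_orderEmbOfFin]; exact ht
    exact this
  have hanti : StrictAnti fun i : Fin (m + 1) => e i.rev := fun i j hij =>
    e.strictMono (Fin.rev_lt_rev.2 hij)
  refine ⟨m, fun i => e i.rev, hanti, ?_, ?_, ?_⟩
  · obtain ⟨i, hi⟩ := hsurj 0 hT0
    refine le_antisymm ?_ (hTsub _ (he _)).1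
    rw [← hi]; simp
  · obtain ⟨i, hi⟩ := hsurj L hTL
    refine le_antisymm (hTsub _ (he _)).2 ?_
    rw [← hi]; apply e.monotone; simp [Fin.le_last]
  · intro k
    have hlt : e k.succ.rev < e k.castSucc.rev := hanti (Fin.castSucc_lt_succ (i := k))
    have hgap : ∀ t ∈ T, t ≤ e k.succ.rev ∨ e k.castSucc.rev ≤ t := by
      intro t ht
      obtain ⟨i, rfl⟩ := hsurj t ht
      rw [e.le_iff_le, e.le_iff_le]
      simp only [Fin.le_def, Fin.val_rev, Fin.val_succ, Fin.val_castSucc]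
      omega
    show ∃ σ u v, Cell X y σ (e k.castSucc.rev) u ∧ Cell X y σ (e k.succ.rev) v
    have h0 := hTsub _ (he k.castSucc.rev)
    have h1 := hTsub _ (he k.succ.rev)
    generalize e k.castSucc.rev = x at *
    generalize e k.succ.rev = z at *
    obtain ⟨σ, hσ⟩ := hcov ((x + z) / 2) ⟨by linarith [h0.1, h1.1], by linarith [h0.2, h1.2]⟩
    have hne : (I σ).Nonempty := ⟨_, hσ⟩
    have hlo := csInf_le (hI σ).bddBelow hσ
    have hhi := le_csSup (hI σ).bddAbove hσ
    have hlo' : sInf (I σ) ≤ z := (hgap _ (hTi σ hne)).resolve_right (by linarith)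
    have hhi' : x ≤ sSup (I σ) := (hgap _ (hTs σ hne)).resolve_left (by linarith)
    obtain ⟨u, hu⟩ := hmem σ _ ((hI σ).sInf_mem hne)
    obtain ⟨v, hv⟩ := hmem σ _ ((hI σ).sSup_mem hne)
    have hw : ∀ w, sInf (I σ) ≤ w → w ≤ sSup (I σ) → ∃ b, Cell X y σ w b := by
      intro w hw1 hw2
      have hs : w ∈ segment ℝ (sInf (I σ)) (sSup (I σ)) := by
        rw [segment_eq_Icc (hw1.trans hw2)]; exact ⟨hw1, hw2⟩
      obtain ⟨a, b, ha, hb, hab, rfl⟩ := hs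
      exact ⟨_, hu.comb X y hv ha hb hab⟩
    obtain ⟨u', hu'⟩ := hw x (by linarith) hhi'
    obtain ⟨v', hv'⟩ := hw z hlo' (by linarith)
    exact ⟨σ, u', v', hu', hv'⟩

/-- Interpolating minimizers along a cell. -/
lemma interp_min {σ : Fin p → SignType} {l l' : ℝ} {u v b : Fin p → ℝ}
    (hu : Cell X y σ l u) (hv : Cell X y σ l' v)
    (hb : (∀ i, res X y b i = res X y u i) ∧ ∑ j, |b j| = ∑ j, |u j|)
    {s t : ℝ} (hs : 0 ≤ s) (ht : 0 ≤ t) (hst : s + t = 1) (hl : 0 ≤ s * l + t * l')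
    (β' : Fin p → ℝ) :
    obj X y (s * l + t * l') (s • b + t • v) ≤ obj X y (s * l + t * l') β' := by
  have hw := hu.comb X y hv hs ht hst
  refine le_trans ?_ (hw.min X y β')
  unfold obj
  have e : ∀ i, res X y (s • b + t • v) i = res X y (s • u + t • v) i := fun i => by
    rw [res_comb X y s t hst, res_comb X y s t hst, hb.1]
  simp only [e]
  have : ∑ j, |(s • b + t • v) j| ≤ ∑ j, |(s • u + t • v) j| := by
    calc ∑ j, |(s • b + t • v) j| ≤ ∑ j, (s * |b j| + t * |v j|) := by
          refine Finset.sum_le_sum fun j _ => ?_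
          simp only [Pi.add_apply, Pi.smul_apply, smul_eq_mul]
          refine (abs_add_le _ _).trans ?_
          rw [abs_mul, abs_mul, abs_of_nonneg hs, abs_of_nonneg ht]
      _ = s * ∑ j, |u j| + t * ∑ j, |v j| := by
          rw [Finset.sum_add_distrib, ← Finset.mul_sum, ← Finset.mul_sum, hb.2]
      _ = ∑ j, |(s • u + t • v) j| := by
          rw [hw.norm_eq, hu.norm_eq, hv.norm_eq, Finset.mul_sum, Finset.mul_sum,
            ← Finset.sum_add_distrib]
          refine Finset.sum_congr rfl fun j _ => ?_
          simp only [Pi.add_apply, Pi.smul_apply, smul_eq_mul]; ring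
  gcongr

/-- Piecewise linear interpolation through prescribed values. -/
lemma exists_interp {m : ℕ} (lam : Fin (m + 1) → ℝ) (hlam : StrictAnti lam)
    (b : Fin (m + 1) → Fin p → ℝ) :
    ∃ (f : ℝ → Fin p → ℝ) (γ : Fin m → Fin p → ℝ), (∀ i, f (lam i) = b i) ∧
      (∀ l, lam 0 ≤ l → f l = b 0) ∧
      (∀ k : Fin m, ∀ l : ℝ, lam k.succ ≤ l → l ≤ lam k.castSucc →
        f l = f (lam k.castSucc) - (l - lam k.castSucc) • γ k) ∧
      (∀ k : Fin m, (lam k.castSucc - lam k.succ) • γ k = b k.succ - b k.castSucc) := by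
  let γ : Fin m → Fin p → ℝ := fun k =>
    (lam k.castSucc - lam k.succ)⁻¹ • (b k.succ - b k.castSucc)
  let h : Fin m → ℝ → ℝ := fun k l =>
    max 0 (min (lam k.castSucc - l) (lam k.castSucc - lam k.succ))
  let f : ℝ → Fin p → ℝ := fun l => b 0 + ∑ k, h k l • γ k
  have hpos : ∀ k : Fin m, 0 < lam k.castSucc - lam k.succ := fun k =>
    sub_pos.2 (hlam (Fin.castSucc_lt_succ (i := k)))
  have hγ : ∀ k : Fin m, (lam k.castSucc - lam k.succ) • γ k = b k.succ - b k.castSucc :=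
    fun k => by simp only [γ]; rw [smul_inv_smul₀ (hpos k).ne']
  have hf0 : ∀ l, lam 0 ≤ l → f l = b 0 := by
    intro l hl
    have : ∀ k, h k l = 0 := fun k => by
      have : lam k.castSucc ≤ lam 0 := hlam.antitone (Fin.zero_le _)
      exact max_eq_left ((min_le_left _ _).trans (by linarith))
    simp [f, this]
  have hst : ∀ k : Fin m, ∀ l : ℝ, lam k.succ ≤ l → l ≤ lam k.castSucc →
        f l = f (lam k.castSucc) - (l - lam k.castSucc) • γ k := by
    intro k l h1 h2
    have key : ∀ j, h j l • γ j = h j (lam k.castSucc) • γ j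
        - (if j = k then (l - lam k.castSucc) • γ k else 0) := by
      intro j
      have hj := hpos j
      rcases lt_trichotomy j k with hjk | rfl | hjk
      · have : lam k.castSucc ≤ lam j.succ := hlam.antitone (by
          simp only [Fin.le_def, Fin.val_succ, Fin.val_castSucc]; exact hjk)
        have e1 : h j l = lam j.castSucc - lam j.succ := by
          simp only [h]; rw [min_eq_right (by linarith), max_eq_right hj.le]
        have e2 : h j (lam k.castSucc) = lam j.castSucc - lam j.succ := by
          simp only [h]; rw [min_eq_right (by linarith), max_eq_right hj.le]
        rw [e1, e2, if_neg hjk.ne, sub_zero]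
      · have e1 : h j l = lam j.castSucc - l := by
          simp only [h]; rw [min_eq_left (by linarith), max_eq_right (by linarith)]
        have e2 : h j (lam j.castSucc) = 0 := by
          simp only [h]; rw [min_eq_left (by linarith), sub_self, max_self]
        rw [e1, e2, if_pos rfl, zero_smul, zero_sub, ← neg_smul, neg_sub]
      · have : lam j.castSucc ≤ lam k.succ := hlam.antitone (by
          simp only [Fin.le_def, Fin.val_succ, Fin.val_castSucc]; exact hjk)
        have e1 : h j l = 0 := max_eq_left ((min_le_left _ _).trans (by linarith))
        have e2 : h j (lam k.castSucc) = 0 :=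
          max_eq_left ((min_le_left _ _).trans (by linarith))
        rw [e1, e2, if_neg hjk.ne', sub_zero]
    simp only [f]
    rw [Finset.sum_congr rfl fun j _ => key j, Finset.sum_sub_distrib]
    simp [add_sub_assoc]
  refine ⟨f, γ, fun i => ?_, hf0, hst, hγ⟩
  induction i using Fin.induction with
  | zero => exact hf0 _ le_rfl
  | succ k ih =>
    rw [hst k _ le_rfl (by linarith [hpos k]), ih, ← neg_smul_neg, neg_sub, smul_neg, hγ k]
    abel

end LassoAux

/-- The Lasso solution path is piecewise linear: there is a selection of minimizers
`βhat : ℝ → ℝᵖ` of `F_λ(β) = ‖y − Xβ‖₂² + λ‖β‖₁`, breakpoints `λ₀ > λ₁ > ⋯ > λ_m = 0`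
and directions `γ_k` with `βhat λ = 0` for `λ ≥ λ₀` and
`βhat λ = βhat λ_k − (λ − λ_k) γ_k` for `λ_{k+1} ≤ λ ≤ λ_k`. -/
theorem lasso_path_piecewise_linear (n p : ℕ) (X : Matrix (Fin n) (Fin p) ℝ)
    (y : Fin n → ℝ) :
    ∃ (βhat : ℝ → Fin p → ℝ) (m : ℕ) (lam : Fin (m + 1) → ℝ)
      (γ : Fin m → Fin p → ℝ),
      (∀ l : ℝ, 0 ≤ l → ∀ β : Fin p → ℝ,
        (∑ i, (y i - ∑ j, X i j * βhat l j) ^ 2) + l * ∑ j, |βhat l j| ≤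
          (∑ i, (y i - ∑ j, X i j * β j) ^ 2) + l * ∑ j, |β j|) ∧
      StrictAnti lam ∧
      lam (Fin.last m) = 0 ∧
      (∀ l : ℝ, lam 0 ≤ l → βhat l = 0) ∧
      (∀ k : Fin m, ∀ l : ℝ, lam k.succ ≤ l → l ≤ lam k.castSucc →
        βhat l = βhat (lam k.castSucc) - (l - lam k.castSucc) • γ k) := by
  classical
  set L : ℝ := ∑ j, |LassoAux.cor X y 0 j| + 1 with hLdef
  have hL : 0 < L := by positivity
  have hzero : ∀ l, L ≤ l → LassoAux.Cell X y (fun _ => 0) l 0 := by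
    intro l hl j
    refine ⟨?_, by simp, by simp⟩
    have := Finset.single_le_sum (f := fun j => |LassoAux.cor X y 0 j|)
      (fun _ _ => abs_nonneg _) (Finset.mem_univ j)
    linarith
  obtain ⟨m, lam, hanti, hlast, h0, hcell⟩ := LassoAux.exists_breakpoints X y L hL
  choose σ u v hu hv using hcell
  let b : Fin (m + 1) → Fin p → ℝ := Fin.cases 0 v
  have hb : ∀ i, ∃ τ, LassoAux.Cell X y τ (lam i) (b i) := by
    intro i
    cases i using Fin.cases with
    | zero => exact ⟨_, hzero _ h0.ge⟩
    | succ k => exact ⟨_, hv k⟩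
  obtain ⟨f, γ, hfb, hf0, hst, hγ⟩ := LassoAux.exists_interp lam hanti b
  refine ⟨f, m, lam, γ, ?_, hanti, hlast, hf0, hst⟩
  intro l hl β
  show LassoAux.obj X y l (f l) ≤ LassoAux.obj X y l β
  rcases le_or_gt L l with hLl | hLl
  · rw [hf0 l (h0.le.trans hLl)]
    exact (hzero l hLl).min X y β
  have hex : ∀ i, lam i ≤ l → ∃ k : Fin m, lam k.succ ≤ l ∧ l ≤ lam k.castSucc := by
    intro i
    induction i using Fin.induction with
    | zero => intro h; linarith
    | succ k ih =>
      intro h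
      rcases le_or_gt (lam k.castSucc) l with h' | h'
      · exact ih h'
      · exact ⟨k, h, h'.le⟩
  obtain ⟨k, hk1, hk2⟩ := hex (Fin.last m) (by rw [hlast]; exact hl)
  have hpos : lam k.succ < lam k.castSucc := hanti (Fin.castSucc_lt_succ (i := k))
  have hk0 : 0 ≤ lam k.succ := by rw [← hlast]; exact hanti.antitone (Fin.le_last _)
  obtain ⟨τ, hτ⟩ := hb k.castSucc
  have huniq := (hu k).unique X y (by linarith) hτ
  have hd : 0 < lam k.castSucc - lam k.succ := by linarith
  set t : ℝ := (lam k.castSucc - l) / (lam k.castSucc - lam k.succ) with ht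
  have ht0 : 0 ≤ t := div_nonneg (by linarith) hd.le
  have ht1 : t ≤ 1 := (div_le_one hd).2 (by linarith)
  have htd : t * (lam k.castSucc - lam k.succ) = lam k.castSucc - l := div_mul_cancel₀ _ hd.ne'
  have hle : l = (1 - t) * lam k.castSucc + t * lam k.succ := by linarith
  have hfl : f l = (1 - t) • b k.castSucc + t • v k := by
    have e : l - lam k.castSucc = - (t * (lam k.castSucc - lam k.succ)) := by linarith
    rw [hst k l hk1 hk2, hfb, e, neg_smul, mul_smul, hγ k]
    show _ = (1 - t) • b k.castSucc + t • b k.succ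
    module
  have := LassoAux.interp_min X y (hu k) (hv k) huniq (sub_nonneg.2 ht1) ht0
    (sub_add_cancel 1 t) (by rw [← hle]; exact hl) β
  rw [← hle, ← hfl] at this
  exact this
end

section
/- Let L, J : ℝᵖ → ℝ be twice continuously differentiable convex functions, let (a,b) ⊆ (0,∞) be an open interval, and let β̂ : (a,b) → ℝᵖ be a differentiable path satisfying the stationarity condition ∇L(β̂(λ)) + λ∇J(β̂(λ)) = 0 for all λ ∈ (a,b). If for every λ ∈ (a,b) the matrix ∇²L(β̂(λ)) + λ∇²J(β̂(λ)) is invertible, then the derivative of the path satisfies ∂β̂(λ)/∂λ = −(∇²L(β̂(λ)) + λ∇²J(β̂(λ)))⁻¹ ∇J(β̂(λ)) for all λ ∈ (a,b). -/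
open Set

/-- The gradient of a `C²` function is differentiable. -/
theorem differentiable_gradient_aux {p : ℕ} {L : EuclideanSpace ℝ (Fin p) → ℝ}
    (hL : ContDiff ℝ 2 L) : Differentiable ℝ (gradient L) := by
  have h1 : Differentiable ℝ (fderiv ℝ L) :=
    (hL.fderiv_right (m := 1) (by norm_num)).differentiable (by norm_num)
  intro x
  exact ((InnerProductSpace.toDual ℝ
    (EuclideanSpace ℝ (Fin p))).symm.toContinuousLinearEquiv.differentiableAt).comp x (h1 x)

/-- For twice continuously differentiable convex loss `L` and penalty `J`, a differentiable
path of stationary points `βhat` of `β ↦ L β + λ J β` on `(a,b) ⊆ (0,∞)` along which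
`∇²L + λ∇²J` is invertible satisfies
`∂βhat(λ)/∂λ = −(∇²L(βhat λ) + λ∇²J(βhat λ))⁻¹ ∇J(βhat λ)`. -/
theorem deriv_of_regularized_path (p : ℕ)
    (L J : EuclideanSpace ℝ (Fin p) → ℝ)
    (hL : ContDiff ℝ 2 L) (hJ : ContDiff ℝ 2 J)
    (hLconv : ConvexOn ℝ univ L) (hJconv : ConvexOn ℝ univ J)
    (a b : ℝ) (ha : 0 ≤ a) (hab : a < b)
    (βhat : ℝ → EuclideanSpace ℝ (Fin p))
    (hdiff : ∀ l ∈ Ioo a b, DifferentiableAt ℝ βhat l)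
    (hstat : ∀ l ∈ Ioo a b, gradient L (βhat l) + l • gradient J (βhat l) = 0)
    (H : ℝ → (EuclideanSpace ℝ (Fin p) ≃L[ℝ] EuclideanSpace ℝ (Fin p)))
    (hH : ∀ l ∈ Ioo a b,
      (H l : EuclideanSpace ℝ (Fin p) →L[ℝ] EuclideanSpace ℝ (Fin p)) =
        fderiv ℝ (gradient L) (βhat l) + l • fderiv ℝ (gradient J) (βhat l)) :
    ∀ l ∈ Ioo a b, deriv βhat l = -((H l).symm (gradient J (βhat l))) := by
  intro l hl
  have hb := (hdiff l hl).hasDerivAt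
  have h1 := (differentiable_gradient_aux hL (βhat l)).hasFDerivAt.comp_hasDerivAt l hb
  have h2 := (differentiable_gradient_aux hJ (βhat l)).hasFDerivAt.comp_hasDerivAt l hb
  have h3 := h1.add ((hasDerivAt_id l).smul h2)
  have h4 : HasDerivAt (fun _ : ℝ => (0 : EuclideanSpace ℝ (Fin p))) _ l :=
    h3.congr_of_eventuallyEq (by
      filter_upwards [Ioo_mem_nhds hl.1 hl.2] with t ht
      exact (hstat t ht).symm)
  have h5 := h4.unique (hasDerivAt_const l _)
  have h6 : H l (deriv βhat l) = -gradient J (βhat l) := by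
    have h7 : H l (deriv βhat l) = (fderiv ℝ (gradient L) (βhat l)
        + l • fderiv ℝ (gradient J) (βhat l)) (deriv βhat l) := by
      rw [← hH l hl]; rfl
    rw [h7, eq_neg_iff_add_eq_zero]
    simpa [add_assoc] using h5
  rw [← map_neg, ← h6, ContinuousLinearEquiv.symm_apply_apply]
end

section
/- Let L : ℝᵖ → ℝ be twice continuously differentiable, J : ℝᵖ → ℝ be continuously differentiable, let (a,b) ⊆ (0,∞) be an open interval, and let β̂ : (a,b) → ℝᵖ be a differentiable path satisfying ∇L(β̂(λ)) + λ∇J(β̂(λ)) = 0 for all λ ∈ (a,b). Suppose there exist an invertible p×p matrix H and a vector v ∈ ℝᵖ such that for all λ ∈ (a,b), the Hessian ∇²L(β̂(λ)) = H and the gradient ∇J(β̂(λ)) = v, and λ ↦ ∇²J composed with the path contributes nothing (i.e., ∇J is constant along the path). Then β̂ is affine on (a,b): for any λ₀, λ ∈ (a,b), β̂(λ) = β̂(λ₀) − (λ − λ₀)H⁻¹v. -/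
open Set

/-- Sufficient condition for a linear piece of the regularized solution path: if along a
differentiable path of stationary points of `β ↦ L β + λ J β` the Hessian `∇²L` is a fixed
invertible matrix `H` and the penalty gradient `∇J` is a fixed vector `v`, then the path is
affine: `βhat λ = βhat λ₀ − (λ − λ₀) H⁻¹ v`. -/
theorem regularized_path_affine_of_constant_hessian_and_penalty_gradient (p : ℕ)
    (L J : EuclideanSpace ℝ (Fin p) → ℝ)
    (hL : ContDiff ℝ 2 L) (hJ : ContDiff ℝ 1 J)
    (a b : ℝ) (ha : 0 ≤ a) (hab : a < b)
    (βhat : ℝ → EuclideanSpace ℝ (Fin p))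
    (hdiff : ∀ l ∈ Ioo a b, DifferentiableAt ℝ βhat l)
    (hstat : ∀ l ∈ Ioo a b, gradient L (βhat l) + l • gradient J (βhat l) = 0)
    (H : EuclideanSpace ℝ (Fin p) ≃L[ℝ] EuclideanSpace ℝ (Fin p))
    (v : EuclideanSpace ℝ (Fin p))
    (hHess : ∀ l ∈ Ioo a b,
      fderiv ℝ (gradient L) (βhat l) =
        (H : EuclideanSpace ℝ (Fin p) →L[ℝ] EuclideanSpace ℝ (Fin p)))
    (hgrad : ∀ l ∈ Ioo a b, gradient J (βhat l) = v) :
    ∀ l₀ ∈ Ioo a b, ∀ l ∈ Ioo a b,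
      βhat l = βhat l₀ - (l - l₀) • H.symm v := by
  have hgd : Differentiable ℝ (gradient L) := by
    have h1 : Differentiable ℝ (fderiv ℝ L) :=
      (hL.fderiv_right (m := 1) (by norm_num)).differentiable (by norm_num)
    exact (InnerProductSpace.toDual ℝ
      (EuclideanSpace ℝ (Fin p))).symm.toContinuousLinearEquiv.differentiable.comp h1
  have hder : ∀ l ∈ Ioo a b, HasDerivAt βhat (-(H.symm v)) l := by
    intro l hl
    have h1 : HasDerivAt (fun t => gradient L (βhat t)) (H (deriv βhat l)) l := by
      have h := (hgd (βhat l)).hasFDerivAt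
      rw [hHess l hl] at h
      exact h.comp_hasDerivAt l (hdiff l hl).hasDerivAt
    have h2 : HasDerivAt (fun t : ℝ => -(t • v)) (-v) l := by
      have h := ((hasDerivAt_id l).smul_const v).neg
      rw [one_smul] at h
      exact h
    have h3 : (fun t => gradient L (βhat t)) =ᶠ[nhds l] fun t : ℝ => -(t • v) := by
      filter_upwards [isOpen_Ioo.mem_nhds hl] with t ht
      have h := hstat t ht
      rw [hgrad t ht] at h
      exact eq_neg_of_add_eq_zero_left h
    have h4 : H (deriv βhat l) = -v := h1.unique (h2.congr_of_eventuallyEq h3)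
    have h5 : deriv βhat l = -(H.symm v) := by
      rw [← map_neg, ← h4, H.symm_apply_apply]
    rw [← h5]
    exact (hdiff l hl).hasDerivAt
  intro l₀ hl₀ l hl
  have hd : ∀ t ∈ Ioo a b, HasDerivAt (fun t => βhat t + t • H.symm v) 0 t := by
    intro t ht
    have h := (hder t ht).add ((hasDerivAt_id t).smul_const (H.symm v))
    rw [one_smul, neg_add_cancel] at h
    exact h
  have key := isOpen_Ioo.is_const_of_deriv_eq_zero (isPreconnected_Ioo (a := a) (b := b))
    (fun t ht => (hd t ht).differentiableAt.differentiableWithinAt)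
    (fun t ht => (hd t ht).deriv) hl hl₀
  rw [sub_smul, eq_sub_of_add_eq key]
  abel
end

section
/- Let X be an n×p real matrix, y ∈ ℝⁿ, λ > 0, A ⊆ {1,…,p}, s ∈ {−1,+1}^A, and suppose the submatrix X_A (columns of X indexed by A) has full column rank. Suppose β ∈ ℝᵖ is supported on A with sign(β_j) = s_j for j ∈ A and satisfies the KKT conditions 2X_Aᵗ(Xβ − y) + λs = 0 and |2x_jᵗ(Xβ − y)| ≤ λ for j ∉ A. Then the restriction of β to A is given explicitly by β_A = (X_AᵗX_A)⁻¹(X_Aᵗy − (λ/2)s). In particular, on any interval of λ values over which the active set A and the sign vector s of the Lasso solution remain fixed, the Lasso solution is an affine function of λ. -/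
open scoped BigOperators
open Matrix

/-- Explicit form of the Lasso solution on its active set: if `β` is supported on `A` with
signs `s`, the columns of `X` indexed by `A` are linearly independent, and `β` satisfies
the KKT conditions `2X_Aᵗ(Xβ − y) + λs = 0` and `|2x_jᵗ(Xβ − y)| ≤ λ` for `j ∉ A`, then
`β_A = (X_AᵗX_A)⁻¹ (X_Aᵗy − (λ/2)s)`. -/
theorem lasso_active_set_formula (n p : ℕ)
    (X : Matrix (Fin n) (Fin p) ℝ) (y : Fin n → ℝ) (l : ℝ) (hl : 0 < l)
    (A : Finset (Fin p)) (s : Fin p → ℝ) (hs : ∀ j ∈ A, s j = 1 ∨ s j = -1)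
    (hrank : LinearIndependent ℝ (fun j : A => fun i : Fin n => X i (j : Fin p)))
    (β : Fin p → ℝ)
    (hsupp : ∀ j ∉ A, β j = 0)
    (hsign : ∀ j ∈ A, Real.sign (β j) = s j)
    (hkkt1 : ∀ j ∈ A,
      2 * (∑ i, X i j * ((∑ k, X i k * β k) - y i)) + l * s j = 0)
    (hkkt2 : ∀ j ∉ A,
      |2 * ∑ i, X i j * ((∑ k, X i k * β k) - y i)| ≤ l) :
    (fun j : A => β (j : Fin p)) =
      (((Matrix.of fun (i : Fin n) (j : A) => X i (j : Fin p))ᵀ *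
          (Matrix.of fun (i : Fin n) (j : A) => X i (j : Fin p)))⁻¹).mulVec
        (fun j : A => (∑ i, X i (j : Fin p) * y i) - l / 2 * s (j : Fin p)) := by
  set M : Matrix (Fin n) A ℝ := Matrix.of fun (i : Fin n) (j : A) => X i (j : Fin p) with hM
  have hinj : Function.Injective M.mulVec := by
    rw [Matrix.mulVec_injective_iff]
    exact hrank
  have hpd : (Mᵀ * M).PosDef := by
    have h := Matrix.PosDef.conjTranspose_mul_self M hinj
    rwa [Matrix.conjTranspose_eq_transpose_of_trivial] at h
  have hdet : IsUnit (Mᵀ * M).det := (Matrix.isUnit_iff_isUnit_det _).mp hpd.isUnit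
  have hXβ : ∀ i, (M *ᵥ (fun j : A => β (j : Fin p))) i = ∑ k, X i k * β k := by
    intro i
    have h1 : (M *ᵥ (fun j : A => β (j : Fin p))) i = ∑ j : A, X i (j : Fin p) * β j := rfl
    rw [h1, Finset.sum_coe_sort A (fun k => X i k * β k)]
    apply Finset.sum_subset (Finset.subset_univ A)
    intro k _ hk
    rw [hsupp k hk, mul_zero]
  have key : (Mᵀ * M) *ᵥ (fun j : A => β (j : Fin p)) =
      (fun j : A => (∑ i, X i (j : Fin p) * y i) - l / 2 * s (j : Fin p)) := by
    funext j
    rw [← Matrix.mulVec_mulVec]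
    have h2 : (Mᵀ *ᵥ (M *ᵥ (fun j : A => β (j : Fin p)))) j =
        ∑ i, X i (j : Fin p) * (M *ᵥ (fun j : A => β (j : Fin p))) i := rfl
    rw [h2]
    simp only [hXβ]
    have h3 := hkkt1 j j.2
    simp only [mul_sub, Finset.sum_sub_distrib] at h3
    linarith
  rw [← key, Matrix.mulVec_mulVec, Matrix.nonsing_inv_mul _ hdet, Matrix.one_mulVec]
end
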